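/- Fix an integer j ≥ 0 and suppose there are sequences a_n, b_n > 0 with a_n^{−1/2}/(A n^a) → 1 and b_n/(B n^b) → 1 for constants A, B, b > 0 and a ∈ ℝ, and ν > −1 with 2a+1 = b(ν+1). Assume, uniformly on compact subsets of ℂ, (−1)^n (a_n^{1/2}/b_n^{j/2}) p_n^{[j]}(c + z²/b_n) → φ_{ν+j}(z) and (−1)^n (a_n^{1/2}/b_n^{(j+1)/2}) p_n^{[j+1]}(c + z²/b_n) → φ_{ν+j+1}(z), and that the leading coefficients satisfy lim_n (γ_n^{[j]}/γ_n^{[j+1]}) · b_n^{1/2}/n = 1/b. Then, uniformly on compact subsets of ℂ, (−1)^n (a_n^{1/2}/b_n^{(j+2)/2}) p_n^{[j+2]}(c + z²/b_n) → φ_{ν+j+2}(z). -/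

import Mathlib

open MeasureTheory Polynomial Filter Topology

noncomputable section

/-- The support of a Borel measure on `ℝ`. -/
def measSupport (μ : Measure ℝ) : Set ℝ := {x | ∀ U ∈ nhds x, μ U ≠ 0}

/-- `P` is a sequence of orthonormal polynomials with respect to the measure `μ`. -/
def IsOPS (μ : Measure ℝ) (P : ℕ → Polynomial ℝ) : Prop :=
  (∀ n, (P n).degree = n) ∧ (∀ n, 0 < (P n).leadingCoeff) ∧
    ∀ n m, (∫ x, (P n).eval x * (P m).eval x ∂μ) = if n = m then 1 else 0

/-- The modified measure `dμ_j(x) = (x-c)^j dμ(x)`. -/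
def muMod (μ : Measure ℝ) (c : ℝ) (j : ℕ) : Measure ℝ :=
  μ.withDensity fun x => ENNReal.ofReal ((x - c) ^ j)

/-- `φ_ν(z) = Σ_{k≥0} (-1)^k z^{2k} / (k! Γ(k+ν+1)) = z^{-ν} J_ν(2z)`. -/
def phi (ν : ℝ) (z : ℂ) : ℂ :=
  ∑' k : ℕ, ((-1 : ℂ) ^ k * z ^ (2 * k)) /
    ((k.factorial : ℂ) * Complex.Gamma ((k : ℂ) + (ν : ℂ) + 1))


theorem exists_sum_eq_of_degree_lt {P : ℕ → ℝ[X]} (hdeg : ∀ n, (P n).degree = n) (n : ℕ) :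
    ∀ f : ℝ[X], f.degree < n → ∃ e : ℕ → ℝ, f = ∑ k ∈ Finset.range n, C (e k) * P k := by
  induction n with
  | zero =>
    intro f hf
    refine ⟨0, ?_⟩
    have : f.degree < 0 := by simpa using hf
    simpa using degree_lt_iff_coeff_zero f 0 |>.1 (by simpa using this) |> fun h => by
      ext m; simpa using h m (Nat.zero_le m)
  | succ n ih =>
    intro f hf
    have hlc : (P n).coeff n ≠ 0 := coeff_ne_zero_of_eq_degree (hdeg n)
    obtain ⟨e, he⟩ := ih (f - C (f.coeff n / (P n).coeff n) * P n) (by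
      rw [degree_lt_iff_coeff_zero] at hf ⊢
      intro m hm
      rcases hm.eq_or_lt with rfl | hlt
      · simp [hlc]
      · rw [coeff_sub, coeff_C_mul, hf m hlt,
          coeff_eq_zero_of_degree_lt (show (P n).degree < (m : WithBot ℕ) by
            rw [hdeg]; exact_mod_cast hlt)]
        simp)
    refine ⟨Function.update e n (f.coeff n / (P n).coeff n), ?_⟩
    rw [Finset.sum_range_succ, Function.update_self, eq_comm, ← eq_sub_iff_add_eq, he]
    refine Finset.sum_congr rfl fun k hk => ?_
    rw [Function.update_of_ne (Finset.mem_range.1 hk).ne]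

/-- Expansion of a polynomial in a system that is orthonormal for a linear functional. -/
theorem eq_sum_of_orthonormal {L : ℝ[X] →ₗ[ℝ] ℝ} {P : ℕ → ℝ[X]}
    (hdeg : ∀ n, (P n).degree = n) (horth : ∀ n m, L (P n * P m) = if n = m then 1 else 0)
    {n : ℕ} {f : ℝ[X]} (hf : f.degree < n) :
    f = ∑ k ∈ Finset.range n, C (L (f * P k)) * P k := by
  obtain ⟨e, he⟩ := exists_sum_eq_of_degree_lt hdeg n f hf
  conv_lhs => rw [he]
  refine Finset.sum_congr rfl fun k hk => ?_
  congr 2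
  rw [he, Finset.sum_mul, map_sum]
  simp_rw [mul_assoc, ← smul_eq_C_mul, map_smul, horth]
  simp [Finset.mem_range.1 hk]

theorem apply_mul_eq_zero_of_orthonormal {L : ℝ[X] →ₗ[ℝ] ℝ} {P : ℕ → ℝ[X]}
    (hdeg : ∀ n, (P n).degree = n) (horth : ∀ n m, L (P n * P m) = if n = m then 1 else 0)
    {n m : ℕ} {f : ℝ[X]} (hf : f.degree < n) (hnm : n ≤ m) : L (P m * f) = 0 := by
  obtain ⟨e, he⟩ := exists_sum_eq_of_degree_lt hdeg n f hf
  rw [he, Finset.mul_sum, map_sum]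
  refine Finset.sum_eq_zero fun k hk => ?_
  rw [mul_left_comm, ← smul_eq_C_mul, map_smul, horth,
    if_neg ((Finset.mem_range.1 hk).trans_le hnm).ne', smul_zero]

/-- The Christoffel–Darboux kernel polynomial `∑_{k ≤ n} P_k(c) P_k`. -/
def cdKernel (P : ℕ → ℝ[X]) (c : ℝ) (n : ℕ) : ℝ[X] :=
  ∑ k ∈ Finset.range (n + 1), C ((P k).eval c) * P k

theorem eval_cdKernel_self (P : ℕ → ℝ[X]) (c : ℝ) (n : ℕ) :
    (cdKernel P c n).eval c = ∑ k ∈ Finset.range (n + 1), ((P k).eval c) ^ 2 := by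
  simp [cdKernel, eval_finsetSum, sq]

theorem eval_cdKernel_self_succ (P : ℕ → ℝ[X]) (c : ℝ) (n : ℕ) :
    (cdKernel P c (n + 1)).eval c = (cdKernel P c n).eval c + ((P (n + 1)).eval c) ^ 2 := by
  simp only [eval_cdKernel_self, Finset.sum_range_succ _ (n + 1)]

theorem eval_cdKernel_self_pos {P : ℕ → ℝ[X]} (hdeg : ∀ n, (P n).degree = n) (c : ℝ) (n : ℕ) :
    0 < (cdKernel P c n).eval c := by
  rw [eval_cdKernel_self]
  have h0 : (P 0).eval c ≠ 0 := by
    have h := eq_C_of_degree_eq_zero (by simpa using hdeg 0 : (P 0).degree = 0)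
    rw [h, eval_C]
    exact coeff_ne_zero_of_eq_degree (hdeg 0)
  exact Finset.sum_pos' (fun k _ => sq_nonneg _) ⟨0, by simp, by positivity⟩

theorem degree_cdKernel_lt {P : ℕ → ℝ[X]} (hdeg : ∀ n, (P n).degree = n) (c : ℝ) (n : ℕ) :
    (cdKernel P c n).degree < (n + 1 : ℕ) := by
  refine (degree_sum_le _ _).trans_lt ((Finset.sup_lt_iff (WithBot.bot_lt_coe _)).2 fun k hk => ?_)
  rw [← smul_eq_C_mul]
  refine (degree_smul_le _ _).trans_lt ?_
  rw [hdeg]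
  exact_mod_cast Finset.mem_range.1 hk

theorem apply_cdKernel_mul {L : ℝ[X] →ₗ[ℝ] ℝ} {P : ℕ → ℝ[X]}
    (hdeg : ∀ n, (P n).degree = n) (horth : ∀ n m, L (P n * P m) = if n = m then 1 else 0)
    (c : ℝ) {n : ℕ} {f : ℝ[X]} (hf : f.degree < (n + 1 : ℕ)) :
    L (cdKernel P c n * f) = f.eval c := by
  conv_rhs => rw [eq_sum_of_orthonormal hdeg horth hf]
  rw [cdKernel, Finset.sum_mul, map_sum, eval_finsetSum]
  refine Finset.sum_congr rfl fun k _ => ?_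
  rw [mul_assoc, ← smul_eq_C_mul, map_smul, eval_mul, eval_C, mul_comm (P k) f, smul_eq_mul,
    mul_comm]

/-- Orthonormal polynomials for the functional `f ↦ L ((X - c)² f)` in terms of those for `L`. -/
theorem X_sub_C_mul_eq_of_orthonormal {L : ℝ[X] →ₗ[ℝ] ℝ} {P Q : ℕ → ℝ[X]} {c : ℝ}
    (hdeg : ∀ n, (P n).degree = n) (hlc : ∀ n, 0 < (P n).leadingCoeff)
    (horth : ∀ n m, L (P n * P m) = if n = m then 1 else 0)
    (hdegQ : ∀ n, (Q n).degree = n) (hlcQ : ∀ n, 0 < (Q n).leadingCoeff)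
    (horthQ : ∀ n m, L ((X - C c) ^ 2 * (Q n * Q m)) = if n = m then 1 else 0) (n : ℕ) :
    (X - C c) * Q n =
      C (√((cdKernel P c n).eval c / (cdKernel P c (n + 1)).eval c)) *
        (P (n + 1) - C ((P (n + 1)).eval c / (cdKernel P c n).eval c) * cdKernel P c n) := by
  set κ := (cdKernel P c n).eval c with hκ
  set κ' := (cdKernel P c (n + 1)).eval c with hκ'
  set y := (P (n + 1)).eval c with hy
  have hκpos : 0 < κ := eval_cdKernel_self_pos hdeg c n
  have hκpos' : 0 < κ' := eval_cdKernel_self_pos hdeg c (n + 1)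
  have hsucc : κ' = κ + y ^ 2 := eval_cdKernel_self_succ P c n
  set s := √(κ / κ') with hs
  have hspos : 0 < s := Real.sqrt_pos.2 (div_pos hκpos hκpos')
  set G := C s * (P (n + 1) - C (y / κ) * cdKernel P c n) with hG
  have hdegK : (C (y / κ) * cdKernel P c n).degree < (n + 1 : ℕ) := by
    rw [← smul_eq_C_mul]
    exact (degree_smul_le _ _).trans_lt (degree_cdKernel_lt hdeg c n)
  have hroot : G.IsRoot c := by
    simp only [IsRoot, hG, eval_mul, eval_sub, eval_C, ← hκ, ← hy]
    field_simp
    ring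
  obtain ⟨r, hr⟩ := dvd_iff_isRoot.2 hroot
  have hdegG0 : (P (n + 1) - C (y / κ) * cdKernel P c n).degree = (n + 1 : ℕ) := by
    rw [degree_sub_eq_left_of_degree_lt (by rwa [hdeg]), hdeg]
  have hdegr : r.degree = n := by
    have h1 : G.degree = (n + 1 : ℕ) := by rw [hG, degree_C_mul hspos.ne', hdegG0]
    rw [hr, degree_mul, degree_X_sub_C] at h1
    have hr0 : r ≠ 0 := by
      rintro rfl
      rw [degree_zero, WithBot.add_bot] at h1
      exact WithBot.bot_ne_coe h1
    rw [degree_eq_natDegree hr0] at h1 ⊢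
    norm_cast at h1 ⊢
    omega
  have hlcr : 0 < r.leadingCoeff := by
    have h1 : G.leadingCoeff = s * (P (n + 1)).leadingCoeff := by
      rw [hG, leadingCoeff_mul, leadingCoeff_C,
        leadingCoeff_sub_of_degree_lt (by rwa [hdeg])]
    rw [hr, leadingCoeff_mul, leadingCoeff_X_sub_C, one_mul] at h1
    rw [h1]
    exact mul_pos hspos (hlc _)
  have hLG : ∀ f : ℝ[X], f.degree < (n + 1 : ℕ) → f.eval c = 0 → L (G * f) = 0 := by
    intro f hf hfc
    rw [hG, mul_assoc, ← smul_eq_C_mul, map_smul, sub_mul, map_sub, mul_assoc, ← smul_eq_C_mul,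
      map_smul, apply_cdKernel_mul hdeg horth c hf, hfc,
      apply_mul_eq_zero_of_orthonormal hdeg horth hf le_rfl]
    simp
  let L2 : ℝ[X] →ₗ[ℝ] ℝ := L ∘ₗ LinearMap.mulLeft ℝ ((X - C c) ^ 2)
  have hL2 : ∀ f, L2 f = L ((X - C c) ^ 2 * f) := fun f => rfl
  have hexp := eq_sum_of_orthonormal (L := L2) hdegQ (fun n m => by rw [hL2, horthQ])
    (n := n + 1) (f := r) (by rw [hdegr]; exact_mod_cast n.lt_succ_self)
  have hzero : ∀ k ∈ Finset.range n, C (L2 (r * Q k)) * Q k = 0 := by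
    intro k hk
    have hk' : k < n := Finset.mem_range.1 hk
    have : L2 (r * Q k) = L (G * ((X - C c) * Q k)) := by
      rw [hL2, hr]; congr 1; ring
    rw [this, hLG _ _ (by simp)]
    · simp
    · rw [degree_mul, degree_X_sub_C, hdegQ]
      norm_cast
      omega
  rw [Finset.sum_range_succ, Finset.sum_eq_zero hzero, zero_add] at hexp
  set e := L2 (r * Q n) with he
  have hsq : L2 (r * r) = 1 := by
    have h1 : L2 (r * r) = L (G * G) := by rw [hL2, hr]; congr 1; ring
    have h2 : L ((P (n + 1) - C (y / κ) * cdKernel P c n) *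
        (P (n + 1) - C (y / κ) * cdKernel P c n)) = κ' / κ := by
      have e1 : (P (n + 1) - C (y / κ) * cdKernel P c n) *
          (P (n + 1) - C (y / κ) * cdKernel P c n) = P (n + 1) * P (n + 1)
          - (2 * (y / κ)) • (P (n + 1) * cdKernel P c n)
          + (y / κ) ^ 2 • (cdKernel P c n * cdKernel P c n) := by
        simp only [smul_eq_C_mul, map_mul, map_pow]
        rw [show (C (2 : ℝ) : ℝ[X]) = 2 from rfl]
        ring
      rw [e1, map_add, map_sub, map_smul, map_smul, horth,
        apply_mul_eq_zero_of_orthonormal hdeg horth (degree_cdKernel_lt hdeg c n) le_rfl,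
        apply_cdKernel_mul hdeg horth c (degree_cdKernel_lt hdeg c n), ← hκ, hsucc]
      simp only [if_true, smul_eq_mul]
      field_simp
      ring
    have h3 : G * G = (s ^ 2) • ((P (n + 1) - C (y / κ) * cdKernel P c n) *
        (P (n + 1) - C (y / κ) * cdKernel P c n)) := by
      rw [hG, smul_eq_C_mul, map_pow]; ring
    rw [h1, h3, map_smul, h2, hs, Real.sq_sqrt (div_pos hκpos hκpos').le, smul_eq_mul]
    field_simp
  have he2 : e ^ 2 = 1 := by
    rw [hexp] at hsq
    have : C e * Q n * (C e * Q n) = (e ^ 2) • (Q n * Q n) := by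
      rw [smul_eq_C_mul, map_pow]; ring
    rw [this, map_smul, hL2, horthQ] at hsq
    simpa using hsq
  have hepos : 0 < e := by
    rw [hexp, leadingCoeff_mul, leadingCoeff_C] at hlcr
    exact pos_of_mul_pos_left hlcr (hlcQ n).le
  have he1 : e = 1 := by nlinarith
  rw [hr, hexp, he1]
  simp

theorem tendsto_rpow_succ_sub_div (γ : ℝ) :
    Tendsto (fun n : ℕ => (((n : ℝ) + 1) ^ γ - (n : ℝ) ^ γ) / ((n : ℝ) + 1) ^ (γ - 1))
      atTop (𝓝 γ) := by
  have hd : HasDerivAt (fun x : ℝ => x ^ γ) γ 1 := by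
    simpa using Real.hasDerivAt_rpow_const (x := 1) (p := γ) (Or.inl one_ne_zero)
  have hs := hasDerivAt_iff_tendsto_slope_zero.1 hd
  have ht : Tendsto (fun n : ℕ => -((n : ℝ) + 1)⁻¹) atTop (𝓝[≠] 0) := by
    refine tendsto_nhdsWithin_iff.2 ⟨?_, Eventually.of_forall fun n => ?_⟩
    · have := (tendsto_one_div_add_atTop_nhds_zero_nat (𝕜 := ℝ)).neg
      simpa using this
    · have : (0 : ℝ) < (n : ℝ) + 1 := by positivity
      simp [this.ne']
  refine (hs.comp ht).congr' (Eventually.of_forall fun n => ?_)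
  have h1 : (0 : ℝ) < (n : ℝ) + 1 := by positivity
  have h2 : (1 : ℝ) + -((n : ℝ) + 1)⁻¹ = n / (n + 1) := by field_simp; ring
  simp only [Function.comp_apply, h2, Real.one_rpow, smul_eq_mul]
  rw [Real.div_rpow n.cast_nonneg h1.le, Real.rpow_sub_one h1.ne']
  have h3 : 0 < ((n : ℝ) + 1) ^ γ := Real.rpow_pos_of_pos h1 _
  field_simp
  ring

/-- Partial sums of a sequence that behaves like `C n^(γ-1)` behave like `(C/γ) n^γ`. -/
theorem tendsto_sum_range_div_rpow {γ : ℝ} (hγ : 0 < γ) {u : ℕ → ℝ} {C : ℝ}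
    (hu : Tendsto (fun n : ℕ => u n / ((n : ℝ) + 1) ^ (γ - 1)) atTop (𝓝 C)) :
    Tendsto (fun n : ℕ => (∑ k ∈ Finset.range (n + 1), u k) / ((n : ℝ) + 1) ^ γ)
      atTop (𝓝 (C / γ)) := by
  set g : ℕ → ℝ := fun n => ((n : ℝ) + 1) ^ γ - (n : ℝ) ^ γ with hg
  have hgpos : ∀ n, 0 < g n := fun n =>
    sub_pos.2 (Real.rpow_lt_rpow n.cast_nonneg (lt_add_one _) hγ)
  have hsum : ∀ n, ∑ k ∈ Finset.range n, g k = (n : ℝ) ^ γ := by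
    intro n
    have := Finset.sum_range_sub (fun k : ℕ => (k : ℝ) ^ γ) n
    simpa [hg, Real.zero_rpow hγ.ne'] using this
  have hlim : Tendsto (fun n => (u n - C / γ * g n) / g n) atTop (𝓝 0) := by
    have h := ((hu.div (tendsto_rpow_succ_sub_div γ) hγ.ne').sub
      (tendsto_const_nhds (x := C / γ)))
    rw [sub_self] at h
    refine h.congr' (Eventually.of_forall fun n => ?_)
    have h1 : (0 : ℝ) < ((n : ℝ) + 1) ^ (γ - 1) := by positivity
    have h2 := hgpos n
    simp only [Pi.div_apply]
    change u n / _ / (g n / _) - _ = _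
    field_simp
  have ho : (fun n => u n - C / γ * g n) =o[atTop] g :=
    (Asymptotics.isLittleO_iff_tendsto fun n h => absurd h (hgpos n).ne').2 hlim
  have hinf : Tendsto (fun n => ∑ k ∈ Finset.range n, g k) atTop atTop := by
    simp_rw [hsum]
    exact (tendsto_rpow_atTop hγ).comp tendsto_natCast_atTop_atTop
  have hs := (ho.sum_range (fun n => (hgpos n).le) hinf).tendsto_div_nhds_zero
  have hs' := ((tendsto_add_atTop_iff_nat 1).2 hs).add_const (C / γ)
  rw [zero_add] at hs'
  refine hs'.congr' (Eventually.of_forall fun n => ?_)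
  have h1 : (0 : ℝ) < ((n : ℝ) + 1) ^ γ := by positivity
  rw [Finset.sum_sub_distrib, ← Finset.mul_sum, hsum]
  push_cast
  field_simp
  ring

/-- The power series coefficients of `phi ν`. -/
def phiCoeff (ν : ℝ) (i : ℕ) : ℝ := (-1) ^ i / (i.factorial * Real.Gamma (i + ν + 1))


theorem phi_eq_tsum (ν : ℝ) (z : ℂ) : phi ν z = ∑' i, (phiCoeff ν i : ℂ) * z ^ (2 * i) := by
  refine tsum_congr fun i => ?_
  simp only [phiCoeff]
  push_cast [← Complex.Gamma_ofReal]
  ring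

theorem phiCoeff_ne_zero {ν : ℝ} (hν : -1 < ν) (i : ℕ) : phiCoeff ν i ≠ 0 := by
  have h : 0 < Real.Gamma (i + ν + 1) := Real.Gamma_pos_of_pos (by
    have : (0 : ℝ) ≤ i := i.cast_nonneg
    linarith)
  rw [phiCoeff]
  positivity

theorem phiCoeff_zero_pos {ν : ℝ} (hν : -1 < ν) : 0 < phiCoeff ν 0 := by
  have h : 0 < Real.Gamma (ν + 1) := Real.Gamma_pos_of_pos (by linarith)
  simpa [phiCoeff] using h

theorem phiCoeff_succ {ν : ℝ} (hν : -1 < ν) (i : ℕ) :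
    phiCoeff ν (i + 1) = -phiCoeff ν i / ((i + 1) * (i + ν + 1)) := by
  have hi : (0 : ℝ) ≤ i := i.cast_nonneg
  have h0 : (i : ℝ) + ν + 1 ≠ 0 := by linarith
  have hG := (Real.Gamma_pos_of_pos (by linarith : 0 < (i : ℝ) + ν + 1)).ne'
  have hf : (i.factorial : ℝ) ≠ 0 := by positivity
  simp only [phiCoeff, Nat.factorial_succ]
  push_cast
  rw [show (i : ℝ) + 1 + ν + 1 = (i + ν + 1) + 1 by ring, Real.Gamma_add_one h0]
  field_simp
  ring

theorem phiCoeff_add_one {ν : ℝ} (hν : -1 < ν) (i : ℕ) :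
    phiCoeff (ν + 1) i = phiCoeff ν i / (i + ν + 1) := by
  have hi : (0 : ℝ) ≤ i := i.cast_nonneg
  have h0 : (i : ℝ) + ν + 1 ≠ 0 := by linarith
  have hG := (Real.Gamma_pos_of_pos (by linarith : 0 < (i : ℝ) + ν + 1)).ne'
  have hf : (i.factorial : ℝ) ≠ 0 := by positivity
  simp only [phiCoeff]
  rw [show (i : ℝ) + (ν + 1) + 1 = (i + ν + 1) + 1 by ring, Real.Gamma_add_one h0]
  field_simp

theorem summable_abs_phiCoeff_mul_pow {ν : ℝ} (hν : -1 < ν) (r : ℝ) :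
    Summable fun i => |phiCoeff ν i| * |r| ^ i := by
  rcases eq_or_ne r 0 with rfl | hr
  · refine summable_of_ne_finset_zero (s := {0}) fun i hi => ?_
    have : i ≠ 0 := by simpa using hi
    simp [this]
  have hr' : 0 < |r| := abs_pos.2 hr
  have hpos : ∀ i, 0 < |phiCoeff ν i| * |r| ^ i := fun i =>
    mul_pos (abs_pos.2 (phiCoeff_ne_zero hν i)) (pow_pos hr' i)
  refine summable_of_ratio_test_tendsto_lt_one (l := 0) one_pos
    (Eventually.of_forall fun i => (hpos i).ne') ?_
  have ht : Tendsto (fun i : ℕ => |r| / (((i : ℝ) + 1) * (i + ν + 1))) atTop (𝓝 0) := by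
    refine tendsto_const_nhds.div_atTop (Tendsto.atTop_mul_atTop₀ ?_ ?_)
    · exact tendsto_atTop_add_const_right _ _ tendsto_natCast_atTop_atTop
    · exact tendsto_atTop_add_const_right _ _
        (tendsto_atTop_add_const_right _ _ tendsto_natCast_atTop_atTop)
  refine ht.congr fun i => ?_
  have hi : (0 : ℝ) ≤ i := i.cast_nonneg
  have h0 : (0 : ℝ) < (i : ℝ) + ν + 1 := by linarith
  have hp := abs_pos.2 (phiCoeff_ne_zero hν i)
  rw [Real.norm_of_nonneg (hpos _).le, Real.norm_of_nonneg (hpos _).le, phiCoeff_succ hν, abs_div,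
    abs_neg, abs_of_pos (by positivity : (0 : ℝ) < ((i : ℝ) + 1) * (i + ν + 1)), pow_succ]
  field_simp

theorem summable_phiCoeff_mul_pow {ν : ℝ} (hν : -1 < ν) (z : ℂ) :
    Summable fun i => (phiCoeff ν i : ℂ) * z ^ (2 * i) := by
  refine Summable.of_norm ?_
  refine (summable_abs_phiCoeff_mul_pow hν (‖z‖ ^ 2)).congr fun i => ?_
  rw [norm_mul, Complex.norm_real, Real.norm_eq_abs, norm_pow, pow_mul, abs_of_nonneg (sq_nonneg ‖z‖)]

theorem differentiable_phi {ν : ℝ} (hν : -1 < ν) : Differentiable ℂ (phi ν) := by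
  intro z
  have h : DifferentiableOn ℂ (fun z => ∑' i, (phiCoeff ν i : ℂ) * z ^ (2 * i))
      (Metric.ball 0 (‖z‖ + 1)) := by
    refine Complex.differentiableOn_tsum_of_summable_norm
      (summable_abs_phiCoeff_mul_pow hν ((‖z‖ + 1) ^ 2)) (fun i => ?_) Metric.isOpen_ball
      fun i w hw => ?_
    · fun_prop
    · have hw' : ‖w‖ ≤ ‖z‖ + 1 := by simpa using (Metric.mem_ball.1 hw).le
      rw [norm_mul, Complex.norm_real, Real.norm_eq_abs, norm_pow, pow_mul,
        abs_of_nonneg (sq_nonneg (‖z‖ + 1))]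
      gcongr
  rw [show phi ν = fun z => ∑' i, (phiCoeff ν i : ℂ) * z ^ (2 * i) from
    funext (phi_eq_tsum ν)]
  exact (h z (by simp)).differentiableAt (Metric.isOpen_ball.mem_nhds (by simp))

theorem phi_zero (ν : ℝ) : phi ν 0 = phiCoeff ν 0 := by
  rw [phi_eq_tsum, tsum_eq_single 0]
  · simp
  · intro i hi
    simp [hi]

/-- The three-term relation between Bessel functions of consecutive orders. -/
theorem sq_mul_phi_add_two {ν : ℝ} (hν : -1 < ν) (z : ℂ) :
    z ^ 2 * phi (ν + 2) z = (ν + 1) * phi (ν + 1) z - phi ν z := by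
  have h1 := (summable_phiCoeff_mul_pow (by linarith : -1 < ν + 1) z).mul_left ((ν : ℂ) + 1)
  have h0 := summable_phiCoeff_mul_pow hν z
  simp only [phi_eq_tsum]
  rw [← tsum_mul_left, ← tsum_mul_left, ← h1.tsum_sub h0, (h1.sub h0).tsum_eq_zero_add]
  have hz : ((ν : ℂ) + 1) * ((phiCoeff (ν + 1) 0 : ℂ) * z ^ (2 * 0)) -
      (phiCoeff ν 0 : ℂ) * z ^ (2 * 0) = 0 := by
    have : (ν : ℂ) + 1 ≠ 0 := by
      exact_mod_cast (by linarith : ν + 1 ≠ 0)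
    rw [phiCoeff_add_one hν]
    simp only [Nat.cast_zero, zero_add]
    push_cast
    field_simp
    ring
  rw [hz, zero_add]
  refine tsum_congr fun i => ?_
  have hi : (0 : ℝ) ≤ i := i.cast_nonneg
  have ha : (i : ℝ) + ν + 1 ≠ 0 := by linarith
  have hb : (i : ℝ) + ν + 2 ≠ 0 := by linarith
  have hc : (i : ℝ) + 1 ≠ 0 := by linarith
  have key : phiCoeff (ν + 2) i = (ν + 1) * phiCoeff (ν + 1) (i + 1) - phiCoeff ν (i + 1) := by
    rw [show ν + 2 = ν + 1 + 1 by ring, phiCoeff_add_one (by linarith : -1 < ν + 1),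
      phiCoeff_add_one hν, phiCoeff_add_one hν, phiCoeff_succ hν]
    push_cast
    have hb' : (i : ℝ) + (ν + 1) + 1 ≠ 0 := by linarith
    have hb'' : (i : ℝ) + 1 + ν + 1 ≠ 0 := by linarith
    field_simp
    ring
  rw [key]
  push_cast
  ring

theorem tendstoUniformlyOn_iff_tendsto_sub {F : ℕ → ℂ → ℂ} {f : ℂ → ℂ} {s : Set ℂ} :
    TendstoUniformlyOn F f atTop s ↔
      Tendsto (fun q : ℕ × ℂ => F q.1 q.2 - f q.2) (atTop ×ˢ 𝓟 s) (𝓝 0) := by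
  rw [tendstoUniformlyOn_iff_tendsto, uniformity_eq_comap_nhds_zero, tendsto_comap_iff]
  rfl

/-- Convergence of bounded multipliers gives uniform convergence of the multiplied series. -/
theorem tendstoUniformlyOn_tsum_phiCoeff {ν : ℝ} (hν : -1 < ν) {s : ℕ → ℕ → ℝ} {t : ℕ → ℝ}
    {S C : ℝ} (hs : ∀ i, Tendsto (fun n => s n i) atTop (𝓝 (t i)))
    (hbound : ∀ n i, |s n i| ≤ S * C ^ i) (hC : 0 ≤ C) (R : ℝ) :
    TendstoUniformlyOn (fun n z => ∑' i, (phiCoeff ν i : ℂ) * (s n i : ℂ) * z ^ (2 * i))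
      (fun z => ∑' i, (phiCoeff ν i : ℂ) * (t i : ℂ) * z ^ (2 * i)) atTop
      (Metric.closedBall 0 R) := by
  rw [tendstoUniformlyOn_iff_tendsto_sub]
  have ht : ∀ i, |t i| ≤ S * C ^ i := fun i =>
    le_of_tendsto (hs i).abs (Eventually.of_forall fun n => hbound n i)
  have hS : 0 ≤ S := by simpa using (abs_nonneg _).trans (hbound 0 0)
  have hsum : Summable fun i => |phiCoeff ν i| * (C * R ^ 2) ^ i * S := by
    have := (summable_abs_phiCoeff_mul_pow hν (C * R ^ 2)).mul_right S
    rwa [abs_of_nonneg (by positivity)] at this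
  have hsum2 : ∀ {a : ℕ → ℝ}, (∀ i, |a i| ≤ S * C ^ i) → ∀ z ∈ Metric.closedBall (0 : ℂ) R,
      Summable fun i => (phiCoeff ν i : ℂ) * (a i : ℂ) * z ^ (2 * i) := by
    intro a ha z hz
    refine Summable.of_norm_bounded hsum fun i => ?_
    have hz' : ‖z‖ ≤ R := by simpa using hz
    rw [norm_mul, norm_mul, Complex.norm_real, Complex.norm_real, Real.norm_eq_abs,
      Real.norm_eq_abs, norm_pow, pow_mul]
    calc |phiCoeff ν i| * |a i| * (‖z‖ ^ 2) ^ i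
        ≤ |phiCoeff ν i| * (S * C ^ i) * (R ^ 2) ^ i := by gcongr; exact ha i
      _ = _ := by rw [mul_pow]; ring
  have hdom : Tendsto (fun n => ∑' i, |phiCoeff ν i| * |s n i - t i| * (R ^ 2) ^ i) atTop
      (𝓝 0) := by
    have := tendsto_tsum_of_dominated_convergence (𝓕 := (atTop : Filter ℕ))
      (f := fun n i => |phiCoeff ν i| * |s n i - t i| * (R ^ 2) ^ i) (g := fun _ => (0 : ℝ))
      (hsum.mul_left 2) (fun i => by
        have h := ((hs i).sub_const (t i)).abs
        rw [sub_self, abs_zero] at h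
        simpa using (h.const_mul |phiCoeff ν i|).mul_const ((R ^ 2) ^ i))
      (Eventually.of_forall fun n i => by
        rw [Real.norm_of_nonneg (by positivity)]
        have h1 : |s n i - t i| ≤ 2 * (S * C ^ i) := by
          have := abs_sub (s n i) (t i)
          linarith [hbound n i, ht i]
        calc |phiCoeff ν i| * |s n i - t i| * (R ^ 2) ^ i
            ≤ |phiCoeff ν i| * (2 * (S * C ^ i)) * (R ^ 2) ^ i := by gcongr
          _ = _ := by rw [mul_pow]; ring)
    simpa using this
  refine squeeze_zero_norm' ?_ (hdom.comp tendsto_fst)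
  rw [eventually_prod_principal_iff]
  refine Eventually.of_forall fun n z hz => ?_
  have hz' : ‖z‖ ≤ R := by simpa using hz
  have hsd : Summable fun i => |phiCoeff ν i| * |s n i - t i| * (R ^ 2) ^ i := by
    refine Summable.of_nonneg_of_le (fun i => by positivity) (fun i => ?_) (hsum.mul_left 2)
    have h1 : |s n i - t i| ≤ 2 * (S * C ^ i) := by
      have := abs_sub (s n i) (t i)
      linarith [hbound n i, ht i]
    calc |phiCoeff ν i| * |s n i - t i| * (R ^ 2) ^ i
        ≤ |phiCoeff ν i| * (2 * (S * C ^ i)) * (R ^ 2) ^ i := by gcongr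
      _ = _ := by rw [mul_pow]; ring
  simp only [Function.comp_apply]
  rw [← (hsum2 (hbound n) z hz).tsum_sub (hsum2 ht z hz)]
  refine tsum_of_norm_bounded hsd.hasSum fun i => ?_
  rw [← sub_mul, ← mul_sub, norm_mul, norm_mul, ← Complex.ofReal_sub, Complex.norm_real,
    Complex.norm_real, Real.norm_eq_abs, Real.norm_eq_abs, norm_pow, pow_mul]
  gcongr

theorem exists_bound_of_tendstoUniformlyOn {F : ℕ → ℂ → ℂ} {f : ℂ → ℂ} {K : Set ℂ}
    (hK : IsCompact K) (hF : ∀ n, ContinuousOn (F n) K) (hf : ContinuousOn f K)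
    (h : TendstoUniformlyOn F f atTop K) :
    ∃ ε : ℕ → ℝ, (∀ n, 0 ≤ ε n) ∧ Tendsto ε atTop (𝓝 0) ∧
      ∀ n, ∀ z ∈ K, ‖F n z - f z‖ ≤ ε n := by
  have hbdd : ∀ n, BddAbove ((fun z => ‖F n z - f z‖) '' K) := fun n =>
    hK.bddAbove_image ((hF n).sub hf).norm
  have h0 : ∀ n, 0 ≤ sSup ((fun z => ‖F n z - f z‖) '' K) := fun n =>
    Real.sSup_nonneg (by rintro _ ⟨z, -, rfl⟩; exact norm_nonneg _)
  refine ⟨fun n => sSup ((fun z => ‖F n z - f z‖) '' K), h0, ?_, fun n z hz =>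
    le_csSup (hbdd n) ⟨z, hz, rfl⟩⟩
  rw [Metric.tendsto_nhds]
  intro ε hε
  filter_upwards [Metric.tendstoUniformlyOn_iff.1 h (ε / 2) (half_pos hε)] with n hn
  rw [Real.dist_eq, sub_zero, abs_of_nonneg (h0 n)]
  refine (Real.sSup_le ?_ (half_pos hε).le).trans_lt (half_lt_self hε)
  rintro _ ⟨z, hz, rfl⟩
  have := (hn z hz).le
  rwa [dist_comm, dist_eq_norm] at this

theorem exists_ratio_bound {b : ℕ → ℝ} (hb : ∀ n, 0 < b n) {B bexp : ℝ} (hB : 0 < B)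
    (hbexp : 0 < bexp)
    (hbB : Tendsto (fun n : ℕ => b n / ((n : ℝ) + 1) ^ bexp) atTop (𝓝 B)) :
    ∃ C : ℝ, 0 ≤ C ∧ ∀ n k : ℕ, k ≤ n + 1 → b k / b n ≤ C := by
  have hpos : ∀ n : ℕ, (0 : ℝ) < ((n : ℝ) + 1) ^ bexp := fun n => by positivity
  obtain ⟨M, hM⟩ := hbB.bddAbove_range
  obtain ⟨m, hm⟩ := (hbB.inv₀ hB.ne').bddAbove_range
  have hM' : ∀ n, b n / ((n : ℝ) + 1) ^ bexp ≤ M := fun n => hM ⟨n, rfl⟩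
  have hm' : ∀ n, (b n / ((n : ℝ) + 1) ^ bexp)⁻¹ ≤ m := fun n => hm ⟨n, rfl⟩
  have hM0 : 0 ≤ M := (div_pos (hb 0) (hpos 0)).le.trans (hM' 0)
  have hm0 : 0 ≤ m := (inv_pos.2 (div_pos (hb 0) (hpos 0))).le.trans (hm' 0)
  refine ⟨M * m * 2 ^ bexp, by positivity, fun n k hk => ?_⟩
  have hk' : (k : ℝ) + 1 ≤ 2 * ((n : ℝ) + 1) := by
    have : (k : ℝ) ≤ n + 1 := by exact_mod_cast hk
    have : (0 : ℝ) ≤ n := n.cast_nonneg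
    linarith
  have h1 : ((k : ℝ) + 1) ^ bexp / ((n : ℝ) + 1) ^ bexp ≤ 2 ^ bexp := by
    rw [div_le_iff₀ (hpos n), ← Real.mul_rpow (by norm_num) (by positivity)]
    exact Real.rpow_le_rpow (by positivity) hk' hbexp.le
  have e : b k / b n = (b k / ((k : ℝ) + 1) ^ bexp) * (b n / ((n : ℝ) + 1) ^ bexp)⁻¹ *
      (((k : ℝ) + 1) ^ bexp / ((n : ℝ) + 1) ^ bexp) := by
    have := hpos n
    have := hpos k
    have := hb n
    field_simp
  have := div_pos (hb n) (hpos n)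
  have := div_pos (hpos k) (hpos n)
  rw [e]
  gcongr
  · exact hM' k
  · exact hm' n

theorem phi_mul_sqrt (ν : ℝ) (z : ℂ) {r : ℝ} (hr : 0 ≤ r) :
    phi ν (z * (√r : ℝ)) = ∑' i, (phiCoeff ν i : ℂ) * ((r ^ i : ℝ) : ℂ) * z ^ (2 * i) := by
  rw [phi_eq_tsum]
  refine tsum_congr fun i => ?_
  rw [mul_pow, pow_mul ((√r : ℝ) : ℂ), ← Complex.ofReal_pow, Real.sq_sqrt hr]
  push_cast
  ring

theorem mul_sqrt_mem_closedBall {z : ℂ} {R r C : ℝ} (hz : z ∈ Metric.closedBall (0 : ℂ) R)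
    (hrC : r ≤ C) : z * (√r : ℝ) ∈ Metric.closedBall (0 : ℂ) (R * √C) := by
  have hz' : ‖z‖ ≤ R := by simpa using hz
  have hR : 0 ≤ R := (norm_nonneg _).trans hz'
  rw [mem_closedBall_zero_iff, norm_mul, Complex.norm_real, Real.norm_of_nonneg (Real.sqrt_nonneg _)]
  gcongr

/-- Weighted averages of functions `F k → phi ν`, rescaled according to a regularly varying
sequence, converge to a multiple of `phi (ν + 1)`. -/
theorem tendstoUniformlyOn_weighted_average {ν : ℝ} (hν : -1 < ν) {v f₀ κ b : ℕ → ℝ}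
    {B bexp D : ℝ} {F : ℕ → ℂ → ℂ}
    (hb : ∀ n, 0 < b n) (hB : 0 < B) (hbexp : 0 < bexp) (hD : 0 < D)
    (hbB : Tendsto (fun n : ℕ => b n / ((n : ℝ) + 1) ^ bexp) atTop (𝓝 B))
    (hv0 : ∀ n, 0 ≤ v n) (hκ0 : ∀ n, 0 < κ n)
    (hv : Tendsto (fun n : ℕ => v n / ((n : ℝ) + 1) ^ (bexp * (ν + 1) - 1)) atTop (𝓝 D))
    (hf₀ : Tendsto f₀ atTop (𝓝 (phiCoeff ν 0)))
    (hκ : Tendsto (fun n : ℕ => κ n / ((n : ℝ) + 1) ^ (bexp * (ν + 1))) atTop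
      (𝓝 (D * phiCoeff ν 0 ^ 2 / (bexp * (ν + 1)))))
    (hFc : ∀ n, Continuous (F n))
    (hF : ∀ K : Set ℂ, IsCompact K → TendstoUniformlyOn F (phi ν) atTop K) (R : ℝ) :
    TendstoUniformlyOn
      (fun n z => (∑ k ∈ Finset.range (n + 1),
        ((v k * f₀ k : ℝ) : ℂ) * F k (z * (√(b k / b n) : ℝ))) / (κ n : ℂ))
      (fun z => ((ν : ℂ) + 1) / (phiCoeff ν 0 : ℂ) * phi (ν + 1) z) atTop
      (Metric.closedBall 0 R) := by
  set β := bexp * (ν + 1) with hβ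
  have hν1 : 0 < ν + 1 := by linarith
  have hβpos : 0 < β := mul_pos hbexp hν1
  set p := phiCoeff ν 0 with hp
  have hp0 : 0 < p := phiCoeff_zero_pos hν
  have hLpos : 0 < D * p ^ 2 / β := by positivity
  obtain ⟨C, hC0, hC⟩ := exists_ratio_bound hb hB hbexp hbB
  have hpw : ∀ (n : ℕ) (x : ℝ), (0 : ℝ) < ((n : ℝ) + 1) ^ x := fun n x => by positivity
  have hratio : ∀ n k, 0 < b k / b n := fun n k => div_pos (hb k) (hb n)
  obtain ⟨ε, hε0, hε, hεF⟩ := exists_bound_of_tendstoUniformlyOn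
    (isCompact_closedBall (0 : ℂ) (R * √C)) (fun n => (hFc n).continuousOn)
    (differentiable_phi hν).continuous.continuousOn (hF _ (isCompact_closedBall _ _))
  have hdiv : ∀ {u : ℕ → ℝ} {l : ℝ},
      Tendsto (fun n : ℕ => u n / ((n : ℝ) + 1) ^ (β - 1)) atTop (𝓝 l) →
      Tendsto (fun n => (∑ k ∈ Finset.range (n + 1), u k) / κ n) atTop
        (𝓝 (l / β / (D * p ^ 2 / β))) := by
    intro u l hu
    refine ((tendsto_sum_range_div_rpow hβpos hu).div hκ hLpos.ne').congr fun n => ?_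
    have := hpw n β
    have := hκ0 n
    simp only [Pi.div_apply]
    field_simp
  have herr : Tendsto (fun n => (∑ k ∈ Finset.range (n + 1), v k * |f₀ k| * ε k) / κ n) atTop
      (𝓝 0) := by
    have h := hdiv (u := fun k => v k * |f₀ k| * ε k) (l := D * |p| * 0)
      (((hv.mul hf₀.abs).mul hε).congr fun n => by ring)
    simpa using h
  obtain ⟨S, hS⟩ := (hdiv (u := fun k => v k * |f₀ k|) (l := D * |p|)
      ((hv.mul hf₀.abs).congr fun n => by ring)).bddAbove_range
  have hS' : ∀ n, (∑ k ∈ Finset.range (n + 1), v k * |f₀ k|) / κ n ≤ S := fun n => hS ⟨n, rfl⟩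
  set s : ℕ → ℕ → ℝ := fun n i =>
    (∑ k ∈ Finset.range (n + 1), v k * f₀ k * (b k / b n) ^ i) / κ n with hs
  have hslim : ∀ i, Tendsto (fun n => s n i) atTop (𝓝 ((ν + 1) / (p * (i + ν + 1)))) := by
    intro i
    have hi : (0 : ℝ) ≤ i := i.cast_nonneg
    have hγ : 0 < β + bexp * i := by positivity
    have h1 := tendsto_sum_range_div_rpow hγ (u := fun k => v k * f₀ k * b k ^ i)
      (C := D * p * B ^ i) (((hv.mul hf₀).mul (hbB.pow i)).congr fun n => by
        have h2 : ((n : ℝ) + 1) ^ (β + bexp * i - 1) =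
            ((n : ℝ) + 1) ^ (β - 1) * (((n : ℝ) + 1) ^ bexp) ^ i := by
          rw [← Real.rpow_mul_natCast (by positivity), ← Real.rpow_add (by positivity)]
          congr 1
          ring
        rw [h2, div_pow]
        have := hpw n (β - 1)
        have := hpw n bexp
        field_simp)
    have h3 := h1.div ((hbB.pow i).mul hκ) (by positivity)
    have e : D * p * B ^ i / (β + bexp * i) / (B ^ i * (D * p ^ 2 / β)) =
        (ν + 1) / (p * (i + ν + 1)) := by
      have : 0 < (i : ℝ) + ν + 1 := by linarith
      rw [show β + bexp * i = bexp * (i + ν + 1) by rw [hβ]; ring, hβ]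
      field_simp
    rw [e] at h3
    refine h3.congr fun n => ?_
    have h2 : ((n : ℝ) + 1) ^ (β + bexp * i) =
        ((n : ℝ) + 1) ^ β * (((n : ℝ) + 1) ^ bexp) ^ i := by
      rw [← Real.rpow_mul_natCast (by positivity), ← Real.rpow_add (by positivity)]
    have h4 : ∑ k ∈ Finset.range (n + 1), v k * f₀ k * (b k / b n) ^ i =
        (∑ k ∈ Finset.range (n + 1), v k * f₀ k * b k ^ i) / b n ^ i := by
      rw [Finset.sum_div]
      exact Finset.sum_congr rfl fun k _ => by rw [div_pow]; ring
    simp only [Pi.div_apply, hs]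
    rw [h2, h4, div_pow]
    have := hpw n β
    have := hpw n bexp
    have := hb n
    have := hκ0 n
    field_simp
  have hsbound : ∀ n i, |s n i| ≤ S * C ^ i := by
    intro n i
    rw [hs, abs_div, abs_of_pos (hκ0 n)]
    calc |∑ k ∈ Finset.range (n + 1), v k * f₀ k * (b k / b n) ^ i| / κ n
        ≤ (∑ k ∈ Finset.range (n + 1), v k * |f₀ k| * C ^ i) / κ n := by
          refine div_le_div_of_nonneg_right ((Finset.abs_sum_le_sum_abs _ _).trans
            (Finset.sum_le_sum fun k hk => ?_)) (hκ0 n).le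
          rw [abs_mul, abs_mul, abs_of_nonneg (hv0 k),
            abs_of_nonneg (pow_nonneg (hratio n k).le i)]
          have := hv0 k
          have := (hratio n k).le
          gcongr
          exact hC n k (Finset.mem_range.1 hk).le
      _ = (∑ k ∈ Finset.range (n + 1), v k * |f₀ k|) / κ n * C ^ i := by
          rw [← Finset.sum_mul]; ring
      _ ≤ S * C ^ i := by gcongr; exact hS' n
  have hmain := tendstoUniformlyOn_iff_tendsto_sub.1
    (tendstoUniformlyOn_tsum_phiCoeff hν hslim hsbound hC0 R)
  rw [tendstoUniformlyOn_iff_tendsto_sub]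
  have hrest : Tendsto (fun q : ℕ × ℂ => (∑ k ∈ Finset.range (q.1 + 1),
      ((v k * f₀ k : ℝ) : ℂ) * (F k (q.2 * (√(b k / b q.1) : ℝ)) -
        phi ν (q.2 * (√(b k / b q.1) : ℝ)))) / (κ q.1 : ℂ))
      (atTop ×ˢ 𝓟 (Metric.closedBall 0 R)) (𝓝 0) := by
    refine squeeze_zero_norm' ?_ (herr.comp tendsto_fst)
    rw [eventually_prod_principal_iff]
    refine Eventually.of_forall fun n z hz => ?_
    simp only [Function.comp_apply]
    rw [norm_div, Complex.norm_real, Real.norm_of_nonneg (hκ0 n).le]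
    refine div_le_div_of_nonneg_right ((norm_sum_le _ _).trans
      (Finset.sum_le_sum fun k hk => ?_)) (hκ0 n).le
    rw [norm_mul, Complex.norm_real, Real.norm_eq_abs, abs_mul, abs_of_nonneg (hv0 k)]
    have := hv0 k
    gcongr
    exact hεF k _ (mul_sqrt_mem_closedBall hz (hC n k (Finset.mem_range.1 hk).le))
  have hadd := hmain.add hrest
  rw [add_zero] at hadd
  refine hadd.congr fun q => ?_
  obtain ⟨n, z⟩ := q
  have hlim : ∑' i, (phiCoeff ν i : ℂ) * (((ν + 1) / (p * (i + ν + 1)) : ℝ) : ℂ) * z ^ (2 * i) =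
      ((ν : ℂ) + 1) / (p : ℂ) * phi (ν + 1) z := by
    rw [phi_eq_tsum, ← tsum_mul_left]
    refine tsum_congr fun i => ?_
    rw [phiCoeff_add_one hν]
    push_cast
    simp only [div_eq_mul_inv, mul_inv]
    ring
  have hsumphi : ∑' i, (phiCoeff ν i : ℂ) * (s n i : ℂ) * z ^ (2 * i) =
      (∑ k ∈ Finset.range (n + 1), ((v k * f₀ k : ℝ) : ℂ) *
        phi ν (z * (√(b k / b n) : ℝ))) / (κ n : ℂ) := by
    have hsm : ∀ k ∈ Finset.range (n + 1), Summable fun i =>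
        ((v k * f₀ k : ℝ) : ℂ) * ((phiCoeff ν i : ℂ) * (((b k / b n) ^ i : ℝ) : ℂ) *
          z ^ (2 * i)) := by
      intro k _
      refine ((summable_phiCoeff_mul_pow hν (z * (√(b k / b n) : ℝ))).congr fun i => ?_).mul_left _
      rw [mul_pow, pow_mul ((√(b k / b n) : ℝ) : ℂ), ← Complex.ofReal_pow,
        Real.sq_sqrt (hratio n k).le]
      push_cast
      ring
    have : ∀ k, ((v k * f₀ k : ℝ) : ℂ) * phi ν (z * (√(b k / b n) : ℝ)) =
        ∑' i, ((v k * f₀ k : ℝ) : ℂ) * ((phiCoeff ν i : ℂ) * (((b k / b n) ^ i : ℝ) : ℂ) *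
          z ^ (2 * i)) := fun k => by
      rw [phi_mul_sqrt ν z (hratio n k).le, tsum_mul_left]
    rw [Finset.sum_congr rfl fun k _ => this k, ← Summable.tsum_finsetSum hsm,
      ← tsum_div_const]
    refine tsum_congr fun i => ?_
    simp only [hs]
    push_cast
    rw [Finset.sum_div, Finset.mul_sum, Finset.sum_mul, Finset.sum_div]
    exact Finset.sum_congr rfl fun k _ => by ring
  simp only [hlim, hsumphi, mul_sub, Finset.sum_sub_distrib, sub_div]
  ring

theorem tendsto_div_rpow_of_tendsto_div_mul_rpow {x : ℕ → ℝ} {A e : ℝ} (hA : 0 < A)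
    (h : Tendsto (fun n : ℕ => x n / (A * (n : ℝ) ^ e)) atTop (𝓝 1)) :
    Tendsto (fun n : ℕ => x n / ((n : ℝ) + 1) ^ e) atTop (𝓝 A) := by
  have h1 : Tendsto (fun n : ℕ => ((n : ℝ) / (n + 1)) ^ e) atTop (𝓝 1) := by
    have := (tendsto_natCast_div_add_atTop (𝕜 := ℝ) 1).rpow_const (p := e)
      (Or.inl one_ne_zero)
    simpa using this
  have h2 := (h.mul h1).mul_const A
  rw [one_mul, one_mul] at h2
  refine h2.congr' ?_
  filter_upwards [eventually_gt_atTop 0] with n hn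
  have hn' : (0 : ℝ) < n := by exact_mod_cast hn
  have hn1 : (0 : ℝ) < (n : ℝ) + 1 := by positivity
  have e1 : 0 < (n : ℝ) ^ e := Real.rpow_pos_of_pos hn' _
  have e2 : 0 < ((n : ℝ) + 1) ^ e := Real.rpow_pos_of_pos hn1 _
  rw [Real.div_rpow hn'.le hn1.le]
  field_simp

theorem tendsto_succ_div_of_tendsto_div_rpow {u : ℕ → ℝ} {x L : ℝ} (hL : L ≠ 0)
    (hu : Tendsto (fun n : ℕ => u n / ((n : ℝ) + 1) ^ x) atTop (𝓝 L)) :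
    Tendsto (fun n => u (n + 1) / u n) atTop (𝓝 1) := by
  have h1 : Tendsto (fun n : ℕ => (((n + 1 : ℕ) : ℝ) / ((n + 1 : ℕ) + 1)) ^ x) atTop (𝓝 1) := by
    have := (tendsto_natCast_div_add_atTop (𝕜 := ℝ) 1).rpow_const (p := x)
      (Or.inl one_ne_zero)
    simpa using (tendsto_add_atTop_iff_nat 1).2 this
  have h2 := (((tendsto_add_atTop_iff_nat 1).2 hu).div hu hL).div h1 one_ne_zero
  rw [div_self hL, div_one] at h2
  refine h2.congr fun n => ?_
  have e1 : (0 : ℝ) < ((n : ℝ) + 1) ^ x := by positivity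
  have e2 : (0 : ℝ) < ((n : ℝ) + 1 + 1) ^ x := by positivity
  simp only [Pi.div_apply]
  push_cast
  rw [Real.div_rpow (by positivity) (by positivity)]
  field_simp

/-- The Mehler–Heine rescaling of a sequence of polynomials. -/
def mhScaled (P : ℕ → ℝ[X]) (c : ℝ) (w b : ℕ → ℝ) (n : ℕ) (z : ℂ) : ℂ :=
  (((-1 : ℝ) ^ n * w n : ℝ) : ℂ) * aeval ((c : ℂ) + z ^ 2 / (b n : ℂ)) (P n)

theorem differentiable_mhScaled (P : ℕ → ℝ[X]) (c : ℝ) (w b : ℕ → ℝ) (n : ℕ) :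
    Differentiable ℂ (mhScaled P c w b n) := by
  have h : Differentiable ℂ fun z : ℂ => aeval ((c : ℂ) + z ^ 2 / (b n : ℂ)) (P n) :=
    (P n).differentiable_aeval.comp
      (g := fun x : ℂ => aeval x (P n)) (f := fun z : ℂ => (c : ℂ) + z ^ 2 / (b n : ℂ)) (by fun_prop)
  exact h.const_mul _

theorem aeval_ofReal (p : ℝ[X]) (c : ℝ) : aeval (c : ℂ) p = ((p.eval c : ℝ) : ℂ) := by
  simpa using aeval_algebraMap_apply ℂ c p

theorem mhScaled_zero (P : ℕ → ℝ[X]) (c : ℝ) (w b : ℕ → ℝ) (n : ℕ) :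
    mhScaled P c w b n 0 = (((-1 : ℝ) ^ n * w n * (P n).eval c : ℝ) : ℂ) := by
  simp [mhScaled, aeval_ofReal]

theorem mhScaled_mul_sqrt (P : ℕ → ℝ[X]) (c : ℝ) (w : ℕ → ℝ) {b : ℕ → ℝ} (hb : ∀ n, 0 < b n)
    (n k : ℕ) (z : ℂ) :
    mhScaled P c w b k (z * (√(b k / b n) : ℝ)) =
      (((-1 : ℝ) ^ k * w k : ℝ) : ℂ) * aeval ((c : ℂ) + z ^ 2 / (b n : ℂ)) (P k) := by
  have hk : (b k : ℂ) ≠ 0 := by exact_mod_cast (hb k).ne'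
  have hn : (b n : ℂ) ≠ 0 := by exact_mod_cast (hb n).ne'
  rw [mhScaled, mul_pow, ← Complex.ofReal_pow, Real.sq_sqrt (div_pos (hb k) (hb n)).le]
  congr 3
  push_cast
  field_simp

theorem aeval_cdKernel_eq_sum (P : ℕ → ℝ[X]) (c : ℝ) {w b : ℕ → ℝ} (hw : ∀ n, 0 < w n)
    (hb : ∀ n, 0 < b n) (n : ℕ) (z : ℂ) :
    aeval ((c : ℂ) + z ^ 2 / (b n : ℂ)) (cdKernel P c n) = ∑ k ∈ Finset.range (n + 1),
      (((w k ^ 2)⁻¹ * ((-1) ^ k * w k * (P k).eval c) : ℝ) : ℂ) *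
        mhScaled P c w b k (z * (√(b k / b n) : ℝ)) := by
  rw [cdKernel, map_sum]
  refine Finset.sum_congr rfl fun k _ => ?_
  rw [mhScaled_mul_sqrt P c w hb, ← mul_assoc, ← Complex.ofReal_mul, map_mul, aeval_C]
  congr 1
  have hwk := (hw k).ne'
  have h1 : ((-1 : ℝ) ^ k) * (-1) ^ k = 1 := by rw [← mul_pow]; simp
  have : (w k ^ 2)⁻¹ * ((-1) ^ k * w k * (P k).eval c) * ((-1) ^ k * w k) = (P k).eval c := by
    field_simp
    linear_combination (P k).eval c * h1
  rw [this]
  rfl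

/-- Uniform convergence on compact sets may be divided by `z²`. -/
theorem tendstoUniformlyOn_of_sq_mul {F : ℕ → ℂ → ℂ} {f : ℂ → ℂ}
    (hF : ∀ n, Differentiable ℂ (F n)) (hf : Differentiable ℂ f)
    (h : ∀ R : ℝ, TendstoUniformlyOn (fun n z => z ^ 2 * F n z) (fun z => z ^ 2 * f z) atTop
      (Metric.closedBall 0 R)) {K : Set ℂ} (hK : IsCompact K) :
    TendstoUniformlyOn F f atTop K := by
  obtain ⟨R₀, hR₀⟩ := hK.isBounded.subset_closedBall 0
  set R := max R₀ 1 with hR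
  have hR1 : 1 ≤ R := le_max_right _ _
  refine TendstoUniformlyOn.mono ?_
    (hR₀.trans (Metric.closedBall_subset_closedBall (le_max_left R₀ 1)))
  rw [Metric.tendstoUniformlyOn_iff]
  intro ε hε
  filter_upwards [Metric.tendstoUniformlyOn_iff.1 (h R) (ε / 2) (half_pos hε)] with n hn z hz
  refine lt_of_le_of_lt ?_ (half_lt_self hε)
  rw [dist_eq_norm]
  refine Complex.norm_le_of_forall_mem_frontier_norm_le (f := fun z => f z - F n z)
    Metric.isBounded_ball (hf.sub (hF n)).diffContOnCl (fun u hu => ?_)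
    (by rwa [closure_ball _ (by positivity)])
  rw [frontier_ball _ (by positivity), mem_sphere_zero_iff_norm] at hu
  have h1 := hn u (by rw [mem_closedBall_zero_iff, hu])
  rw [dist_eq_norm, ← mul_sub, norm_mul, norm_pow, hu] at h1
  nlinarith [norm_nonneg (f u - F n u), mul_le_mul hR1 hR1 zero_le_one (by linarith)]

theorem tendstoUniformlyOn_mhScaled_of_relation {ν : ℝ} (hν : -1 < ν) {P Q : ℕ → ℝ[X]} {c : ℝ}
    {w b : ℕ → ℝ} {B bexp D : ℝ} (hdeg : ∀ n, (P n).degree = n)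
    (hrel : ∀ n, (X - C c) * Q n =
      C (√((cdKernel P c n).eval c / (cdKernel P c (n + 1)).eval c)) *
        (P (n + 1) - C ((P (n + 1)).eval c / (cdKernel P c n).eval c) * cdKernel P c n))
    (hw : ∀ n, 0 < w n) (hb : ∀ n, 0 < b n) (hB : 0 < B) (hbexp : 0 < bexp) (hD : 0 < D)
    (hbB : Tendsto (fun n : ℕ => b n / ((n : ℝ) + 1) ^ bexp) atTop (𝓝 B))
    (hwD : Tendsto (fun n : ℕ => (w n ^ 2)⁻¹ / ((n : ℝ) + 1) ^ (bexp * (ν + 1) - 1))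
      atTop (𝓝 D))
    (hMH : ∀ K : Set ℂ, IsCompact K →
      TendstoUniformlyOn (mhScaled P c w b) (phi ν) atTop K)
    {K : Set ℂ} (hK : IsCompact K) :
    TendstoUniformlyOn (mhScaled Q c (fun n => w n / b n) b) (phi (ν + 2)) atTop K := by
  refine tendstoUniformlyOn_of_sq_mul (fun n => differentiable_mhScaled _ _ _ _ n)
    (differentiable_phi (by linarith)) (fun R => ?_) hK
  have hν1 : 0 < ν + 1 := by linarith
  have hp0 : 0 < phiCoeff ν 0 := phiCoeff_zero_pos hν
  set f₀ : ℕ → ℝ := fun n => (-1) ^ n * w n * (P n).eval c with hf₀def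
  set κ : ℕ → ℝ := fun n => (cdKernel P c n).eval c with hκdef
  have hκ0 : ∀ n, 0 < κ n := eval_cdKernel_self_pos hdeg c
  have hf₀ : Tendsto f₀ atTop (𝓝 (phiCoeff ν 0)) := by
    have h := (hMH {0} isCompact_singleton).tendsto_at (Set.mem_singleton 0)
    rw [phi_zero] at h
    exact (Complex.continuous_re.tendsto _).comp h |>.congr fun n => by
      simp [mhScaled_zero, hf₀def, -Complex.ofReal_mul, -Complex.ofReal_pow]
  have hκ : Tendsto (fun n : ℕ => κ n / ((n : ℝ) + 1) ^ (bexp * (ν + 1))) atTop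
      (𝓝 (D * phiCoeff ν 0 ^ 2 / (bexp * (ν + 1)))) := by
    have h := tendsto_sum_range_div_rpow (mul_pos hbexp hν1)
      (u := fun k => (w k ^ 2)⁻¹ * f₀ k ^ 2) ((hwD.mul (hf₀.pow 2)).congr fun n => by ring)
    refine h.congr fun n => ?_
    simp only [hκdef]
    rw [eval_cdKernel_self]
    congr 1
    refine Finset.sum_congr rfl fun k _ => ?_
    have := (hw k).ne'
    have h1 : ((-1 : ℝ) ^ k) ^ 2 = 1 := by rw [← pow_mul, mul_comm, pow_mul]; simp
    simp only [hf₀def, mul_pow, h1]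
    field_simp
  have hκ1 : Tendsto (fun n => √(κ n / κ (n + 1))) atTop (𝓝 1) := by
    have h := ((tendsto_succ_div_of_tendsto_div_rpow (by positivity) hκ).inv₀ one_ne_zero).sqrt
    simpa using h
  have hw1 : Tendsto (fun n => w n / w (n + 1)) atTop (𝓝 1) := by
    have h := (tendsto_succ_div_of_tendsto_div_rpow hD.ne' hwD).sqrt
    rw [Real.sqrt_one] at h
    refine h.congr fun n => ?_
    have e : (w (n + 1) ^ 2)⁻¹ / (w n ^ 2)⁻¹ = (w n / w (n + 1)) ^ 2 := by
      rw [div_pow, inv_div_inv]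
    rw [e, Real.sqrt_sq (div_pos (hw _) (hw _)).le]
  have hc1 : Tendsto (fun n => ((√(κ n / κ (n + 1)) * (w n / w (n + 1)) : ℝ) : ℂ)) atTop
      (𝓝 1) := by
    have h := (Complex.continuous_ofReal.tendsto _).comp (hκ1.mul hw1)
    rwa [mul_one, Complex.ofReal_one] at h
  have hd : Tendsto (fun n => (f₀ (n + 1) : ℂ)) atTop (𝓝 (phiCoeff ν 0 : ℂ)) :=
    (Complex.continuous_ofReal.tendsto _).comp ((tendsto_add_atTop_iff_nat 1).2 hf₀)
  obtain ⟨Cb, hCb0, hCb⟩ := exists_ratio_bound hb hB hbexp hbB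
  have hnext : Tendsto (fun q : ℕ × ℂ =>
      mhScaled P c w b (q.1 + 1) (q.2 * (√(b (q.1 + 1) / b q.1) : ℝ)) - phi ν q.2)
      (atTop ×ˢ 𝓟 (Metric.closedBall 0 R)) (𝓝 0) := by
    obtain ⟨ε, -, hε, hεF⟩ := exists_bound_of_tendstoUniformlyOn
      (isCompact_closedBall (0 : ℂ) (R * √Cb))
      (fun n => (differentiable_mhScaled P c w b n).continuous.continuousOn)
      (differentiable_phi hν).continuous.continuousOn (hMH _ (isCompact_closedBall _ _))
    have h1 : Tendsto (fun q : ℕ × ℂ =>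
        mhScaled P c w b (q.1 + 1) (q.2 * (√(b (q.1 + 1) / b q.1) : ℝ)) -
          phi ν (q.2 * (√(b (q.1 + 1) / b q.1) : ℝ)))
        (atTop ×ˢ 𝓟 (Metric.closedBall 0 R)) (𝓝 0) := by
      refine squeeze_zero_norm' ?_ (((tendsto_add_atTop_iff_nat 1).2 hε).comp tendsto_fst)
      rw [eventually_prod_principal_iff]
      exact Eventually.of_forall fun n z hz =>
        hεF _ _ (mul_sqrt_mem_closedBall hz (hCb n (n + 1) le_rfl))
    have hbr := tendsto_succ_div_of_tendsto_div_rpow hB.ne' hbB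
    have h2 := tendstoUniformlyOn_iff_tendsto_sub.1 (tendstoUniformlyOn_tsum_phiCoeff hν
      (s := fun n i => (b (n + 1) / b n) ^ i) (t := fun _ => 1) (S := 1) (C := Cb)
      (fun i => by simpa using hbr.pow i)
      (fun n i => by
        have := (div_pos (hb (n + 1)) (hb n)).le
        rw [abs_of_nonneg (pow_nonneg this i), one_mul]
        exact pow_le_pow_left₀ this (hCb n (n + 1) le_rfl) i) hCb0 R)
    have h3 := h1.add h2
    rw [add_zero] at h3
    refine h3.congr fun q => ?_
    rw [phi_mul_sqrt ν _ (div_pos (hb _) (hb _)).le, phi_eq_tsum ν q.2]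
    simp
  set H : ℂ → ℂ := fun z => ((ν : ℂ) + 1) / (phiCoeff ν 0 : ℂ) * phi (ν + 1) z with hHdef
  have hHc : Continuous H :=
    continuous_const.mul (differentiable_phi (by linarith)).continuous
  have havg := tendstoUniformlyOn_iff_tendsto_sub.1
    (tendstoUniformlyOn_weighted_average hν (v := fun n => (w n ^ 2)⁻¹) hb hB hbexp hD hbB
      (fun n => by positivity) hκ0 hwD hf₀ hκ
      (fun n => (differentiable_mhScaled P c w b n).continuous) hMH R)
  have hbdd : ∀ g : ℂ → ℂ, Continuous g → IsBoundedUnder (· ≤ ·)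
      ((atTop : Filter ℕ) ×ˢ 𝓟 (Metric.closedBall (0 : ℂ) R)) (norm ∘ fun q : ℕ × ℂ => g q.2) := by
    intro g hg
    obtain ⟨M, hM⟩ := (isCompact_closedBall (0 : ℂ) R).exists_bound_of_continuousOn
      hg.continuousOn
    refine isBoundedUnder_of_eventually_le (a := M) ?_
    rw [eventually_prod_principal_iff]
    exact Eventually.of_forall fun n z hz => hM z hz
  set g : ℂ → ℂ := fun z => (phiCoeff ν 0 : ℂ) * H z - phi ν z with hgdef
  have hgc : Continuous g :=
    (continuous_const.mul hHc).sub (differentiable_phi hν).continuous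
  have hgphi : ∀ z, g z = z ^ 2 * phi (ν + 2) z := by
    intro z
    have : (phiCoeff ν 0 : ℂ) ≠ 0 := by exact_mod_cast hp0.ne'
    rw [sq_mul_phi_add_two hν, hgdef, hHdef]
    field_simp
  have hcl := hc1.comp (tendsto_fst (f := (atTop : Filter ℕ))
    (g := 𝓟 (Metric.closedBall (0 : ℂ) R)))
  have hdl := hd.comp (tendsto_fst (f := (atTop : Filter ℕ))
    (g := 𝓟 (Metric.closedBall (0 : ℂ) R)))
  have hc1' := hcl.sub_const 1
  rw [sub_self] at hc1'
  have hd' := hdl.sub_const (phiCoeff ν 0 : ℂ)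
  rw [sub_self] at hd'
  have htot := (hcl.mul (((hdl.mul havg).add
    (hd'.zero_mul_isBoundedUnder_le (hbdd H hHc))).sub hnext)).add
    (hc1'.zero_mul_isBoundedUnder_le (hbdd g hgc))
  rw [tendstoUniformlyOn_iff_tendsto_sub]
  simp only [mul_zero, add_zero, sub_zero] at htot
  refine htot.congr fun q => ?_
  obtain ⟨n, z⟩ := q
  have hbn : (b n : ℂ) ≠ 0 := by exact_mod_cast (hb n).ne'
  have hwn : (w (n + 1) : ℂ) ≠ 0 := by exact_mod_cast (hw (n + 1)).ne'
  have hκn : (κ n : ℂ) ≠ 0 := by exact_mod_cast (hκ0 n).ne'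
  have hkey : z ^ 2 * mhScaled Q c (fun n => w n / b n) b n z =
      ((√(κ n / κ (n + 1)) * (w n / w (n + 1)) : ℝ) : ℂ) * ((f₀ (n + 1) : ℂ) *
        ((∑ k ∈ Finset.range (n + 1), (((w k ^ 2)⁻¹ * f₀ k : ℝ) : ℂ) *
          mhScaled P c w b k (z * (√(b k / b n) : ℝ))) / (κ n : ℂ)) -
        mhScaled P c w b (n + 1) (z * (√(b (n + 1) / b n) : ℝ))) := by
    have h := congrArg (aeval ((c : ℂ) + z ^ 2 / (b n : ℂ))) (hrel n)
    simp only [map_mul, map_sub, aeval_X, aeval_C, Complex.coe_algebraMap,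
      add_sub_cancel_left] at h
    rw [← aeval_cdKernel_eq_sum P c hw hb, mhScaled_mul_sqrt P c w hb, mhScaled]
    have e : z ^ 2 * ((((-1 : ℝ) ^ n * (w n / b n) : ℝ) : ℂ) *
        aeval ((c : ℂ) + z ^ 2 / (b n : ℂ)) (Q n)) = (-1) ^ n * (w n : ℂ) *
        (z ^ 2 / (b n : ℂ) * aeval ((c : ℂ) + z ^ 2 / (b n : ℂ)) (Q n)) := by
      push_cast
      ring
    rw [e, h]
    simp only [hf₀def]
    push_cast
    change _ * (_ * (_ - _ / (κ n : ℂ) * _)) = _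
    field_simp
    ring
  rw [← hgphi, hkey]
  simp only [Function.comp_apply, hgdef]
  ring

theorem integrable_eval_muMod {μ : Measure ℝ}
    (hint : ∀ p : ℝ[X], Integrable (fun x => p.eval x) μ) (c : ℝ) (j : ℕ) (p : ℝ[X]) :
    Integrable (fun x => p.eval x) (muMod μ c j) := by
  rw [muMod, integrable_withDensity_iff_integrable_smul' (by fun_prop)
    (Eventually.of_forall fun x => ENNReal.ofReal_lt_top)]
  refine (hint ((X - C c) ^ j * p)).mono (Measurable.aestronglyMeasurable (by fun_prop))
    (Eventually.of_forall fun x => ?_)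
  simp only [eval_mul, eval_pow, eval_sub, eval_X, eval_C, smul_eq_mul, norm_mul,
    ENNReal.toReal_ofReal', Real.norm_eq_abs]
  refine mul_le_mul_of_nonneg_right ?_ (abs_nonneg _)
  rw [abs_of_nonneg (le_max_right _ _)]
  exact max_le (le_abs_self _) (abs_nonneg _)

theorem integral_muMod_add_two (μ : Measure ℝ) (c : ℝ) (j : ℕ) (p : ℝ[X]) :
    ∫ x, p.eval x ∂(muMod μ c (j + 2)) = ∫ x, ((X - C c) ^ 2 * p).eval x ∂(muMod μ c j) := by
  rw [muMod, muMod, integral_withDensity_eq_integral_toReal_smul (by fun_prop)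
    (Eventually.of_forall fun x => ENNReal.ofReal_lt_top),
    integral_withDensity_eq_integral_toReal_smul (by fun_prop)
    (Eventually.of_forall fun x => ENNReal.ofReal_lt_top)]
  refine integral_congr_ae (Eventually.of_forall fun x => ?_)
  simp only [eval_mul, eval_pow, eval_sub, eval_X, eval_C, smul_eq_mul, ENNReal.toReal_ofReal']
  rw [pow_add, ← zero_mul ((x - c) ^ 2), ← max_mul_of_nonneg _ _ (sq_nonneg (x - c)), zero_mul]
  ring

/-- Integration of polynomials as a linear functional. -/
def polyIntegral (μ : Measure ℝ) (hint : ∀ p : ℝ[X], Integrable (fun x => p.eval x) μ) :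
    ℝ[X] →ₗ[ℝ] ℝ where
  toFun p := ∫ x, p.eval x ∂μ
  map_add' p q := by
    simp only [eval_add]
    exact integral_add (hint p) (hint q)
  map_smul' r p := by
    simp only [eval_smul, smul_eq_mul, RingHom.id_apply]
    exact integral_const_mul _ _

/-- **Induction step in Proposition 1.** If the Mehler–Heine type formula holds for two
consecutive indices `j` and `j+1` and
`(γ_n^{[j]}/γ_n^{[j+1]}) b_n^{1/2}/n → 1/b`, then it holds for `j+2`. -/
theorem mehler_heine_induction_step
    (μ : Measure ℝ) [IsFiniteMeasure μ]
    (hsupp : (measSupport μ).Infinite)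
    (hint : ∀ p : Polynomial ℝ, Integrable (fun x => p.eval x) μ)
    (c : ℝ) (j : ℕ)
    (P : ℕ → ℕ → Polynomial ℝ)
    (hP : ∀ i, IsOPS (muMod μ c i) (P i))
    (a b : ℕ → ℝ) (ha : ∀ n, 0 < a n) (hb : ∀ n, 0 < b n)
    (A B bexp : ℝ) (aexp : ℝ) (hA : 0 < A) (hB : 0 < B) (hbexp : 0 < bexp)
    (ν : ℝ) (hν : -1 < ν)
    (haA : Filter.Tendsto (fun n : ℕ => (a n) ^ (-(1 : ℝ) / 2) / (A * (n : ℝ) ^ aexp))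
      Filter.atTop (nhds 1))
    (hbB : Filter.Tendsto (fun n : ℕ => b n / (B * (n : ℝ) ^ bexp)) Filter.atTop (nhds 1))
    (hlink : 2 * aexp + 1 = bexp * (ν + 1))
    (hMHj : ∀ K : Set ℂ, IsCompact K →
      TendstoUniformlyOn
        (fun (n : ℕ) (z : ℂ) =>
          (((-1 : ℝ) ^ n * ((a n) ^ ((1 : ℝ) / 2) / (b n) ^ ((j : ℝ) / 2)) : ℝ) : ℂ) *
            Polynomial.aeval ((c : ℂ) + z ^ 2 / (b n : ℂ)) (P j n))
        (fun z => phi (ν + j) z) Filter.atTop K)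
    (hMHj1 : ∀ K : Set ℂ, IsCompact K →
      TendstoUniformlyOn
        (fun (n : ℕ) (z : ℂ) =>
          (((-1 : ℝ) ^ n * ((a n) ^ ((1 : ℝ) / 2) / (b n) ^ (((j : ℝ) + 1) / 2)) : ℝ) : ℂ) *
            Polynomial.aeval ((c : ℂ) + z ^ 2 / (b n : ℂ)) (P (j + 1) n))
        (fun z => phi (ν + j + 1) z) Filter.atTop K)
    (hgamma : Filter.Tendsto
      (fun n : ℕ =>
        (P j n).leadingCoeff / (P (j + 1) n).leadingCoeff * ((b n) ^ ((1 : ℝ) / 2) / n))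
      Filter.atTop (nhds (1 / bexp))) :
    ∀ K : Set ℂ, IsCompact K →
      TendstoUniformlyOn
        (fun (n : ℕ) (z : ℂ) =>
          (((-1 : ℝ) ^ n * ((a n) ^ ((1 : ℝ) / 2) / (b n) ^ (((j : ℝ) + 2) / 2)) : ℝ) : ℂ) *
            Polynomial.aeval ((c : ℂ) + z ^ 2 / (b n : ℂ)) (P (j + 2) n))
        (fun z => phi (ν + j + 2) z) Filter.atTop K := by
  have hnu : -1 < ν + j := by
    have : (0 : ℝ) ≤ j := j.cast_nonneg
    linarith
  have hintj := integrable_eval_muMod hint c j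
  have hrel := X_sub_C_mul_eq_of_orthonormal (L := polyIntegral _ hintj) (c := c)
    (hP j).1 (hP j).2.1 (fun n m => by
      simpa only [polyIntegral, LinearMap.coe_mk, AddHom.coe_mk, eval_mul] using (hP j).2.2 n m)
    (hP (j + 2)).1 (hP (j + 2)).2.1 (fun n m => by
      rw [← (hP (j + 2)).2.2 n m]
      refine (integral_muMod_add_two μ c j (P (j + 2) n * P (j + 2) m)).symm.trans ?_
      simp only [eval_mul])
  have hbB' := tendsto_div_rpow_of_tendsto_div_mul_rpow hB hbB
  have haA' := tendsto_div_rpow_of_tendsto_div_mul_rpow hA haA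
  set w : ℕ → ℝ := fun n => a n ^ ((1 : ℝ) / 2) / b n ^ ((j : ℝ) / 2) with hwdef
  have hw : ∀ n, 0 < w n := fun n =>
    div_pos (Real.rpow_pos_of_pos (ha n) _) (Real.rpow_pos_of_pos (hb n) _)
  have hwD : Tendsto (fun n : ℕ => (w n ^ 2)⁻¹ / ((n : ℝ) + 1) ^ (bexp * (ν + j + 1) - 1))
      atTop (𝓝 (A ^ 2 * B ^ j)) := by
    refine ((haA'.pow 2).mul (hbB'.pow j)).congr fun n => ?_
    have hn : (0 : ℝ) < (n : ℝ) + 1 := by positivity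
    have e1 : ((n : ℝ) + 1) ^ (bexp * (ν + j + 1) - 1) =
        (((n : ℝ) + 1) ^ aexp) ^ 2 * (((n : ℝ) + 1) ^ bexp) ^ j := by
      rw [← Real.rpow_mul_natCast hn.le, ← Real.rpow_mul_natCast hn.le, ← Real.rpow_add hn]
      congr 1
      push_cast
      linear_combination -hlink
    have e2 : (a n ^ (-(1 : ℝ) / 2)) ^ 2 = (a n)⁻¹ := by
      rw [← Real.rpow_mul_natCast (ha n).le, ← Real.rpow_neg_one]
      norm_num
    have e3 : (a n ^ ((1 : ℝ) / 2)) ^ 2 = a n := by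
      rw [← Real.rpow_mul_natCast (ha n).le]
      norm_num
    have e4 : (b n ^ ((j : ℝ) / 2)) ^ 2 = b n ^ j := by
      rw [← Real.rpow_mul_natCast (hb n).le, ← Real.rpow_natCast]
      norm_num
    simp only [hwdef]
    rw [div_pow, div_pow, div_pow, e1, e2, e3, e4]
    have := ha n
    field_simp
  intro K hK
  have hmain := tendstoUniformlyOn_mhScaled_of_relation hnu (hP j).1 hrel hw hb hB hbexp
    (by positivity) hbB' hwD hMHj hK
  refine hmain.congr (Eventually.of_forall fun n z _ => ?_)
  have e : b n ^ (((j : ℝ) + 2) / 2) = b n ^ ((j : ℝ) / 2) * b n := by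
    rw [add_div, div_self two_ne_zero, Real.rpow_add_one (hb n).ne']
  simp only [mhScaled, hwdef]
  rw [e, div_div]
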